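/- Let c = (c₁,…,cₙ) ∈ 𝒜⁺ and let k = |{ i ∈ {1,…,n} : c_i = 1 }| be the number of ears of c. Then |{ i ∈ {1,…,n} : |m_i| > 1 }| ≤ k. -/

import Mathlib

open Matrix Finset

/-- The matrix `η(a)` with rows `(a, -1)` and `(1, 0)`. -/
def etaM (a : ℤ) : Matrix (Fin 2) (Fin 2) ℤ := !![a, -1; 1, 0]

/-- The set `𝒜⁺` of η-sequences, as an inductive predicate on lists of integers. -/
inductive IsEta : List ℤ → Prop
  | base : IsEta [0, 0]
  | rotate {c : List ℤ} : IsEta c → IsEta (c.rotate 1)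
  | reverse {c : List ℤ} : IsEta c → IsEta c.reverse
  | expand {a b : ℤ} {t : List ℤ} : IsEta (a :: b :: t) → IsEta ((a + 1) :: 1 :: (b + 1) :: t)

/-- The `i`-th entry (1-indexed) of a sequence. -/
def entryOf (c : List ℤ) (i : ℕ) : ℤ := c.getD (i - 1) 0

/-- `φ_i(j)`: `0` if `i = j`; the (2,1)-entry of `η(c_i)⋯η(c_{j-1})` if `i < j`;
the (2,1)-entry of `η(c_j)⋯η(c_{i-1})` if `j < i`.  (Indices are 1-based.) -/
def phi (c : List ℤ) (i j : ℕ) : ℤ :=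
  if i = j then 0
  else if i < j then (((c.drop (i - 1)).take (j - i)).map etaM).prod 1 0
  else (((c.drop (j - 1)).take (i - j)).map etaM).prod 1 0

open Classical in
/-- `m_i`: the set of positions `j ∈ {1,…,n}` where `φ_i` attains its maximum. -/
noncomputable def mset (c : List ℤ) (i : ℕ) : Finset ℕ :=
  (Finset.Icc 1 c.length).filter (fun j => ∀ l ∈ Finset.Icc 1 c.length, phi c i l ≤ phi c i j)

/-- `i ⊕ k`: addition of 1-based indices, wrapping around modulo `n` (for `i + k ≤ 2n`). -/
def addIdx (n i k : ℕ) : ℕ := if i + k ≤ n then i + k else i + k - n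

/-- `c` is dense if for every `i ∈ {1,…,n}`, `|m_i| > 1` or `|m_{i+1}| > 1`
(indices taken cyclically). -/
def DenseSeq (c : List ℤ) : Prop :=
  ∀ i ∈ Finset.Icc 1 c.length,
    1 < (mset c i).card ∨ 1 < (mset c (addIdx c.length i 1)).card

/-- `c` is fan-shaped if a cyclic rotation of `c` equals `(n-2, 1, 2, …, 2, 1)`. -/
def IsFan (c : List ℤ) : Prop :=
  ∃ k, c.rotate k =
    ((c.length : ℤ) - 2) :: 1 :: (List.replicate (c.length - 3) (2 : ℤ) ++ [1])

/-- The product of the matrices `η(a)` over the entries `a` of a list. -/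
def etaProd (l : List ℤ) : Matrix (Fin 2) (Fin 2) ℤ := (l.map etaM).prod

theorem etaProd_nil : etaProd [] = 1 := rfl

theorem etaProd_cons (a : ℤ) (l : List ℤ) : etaProd (a :: l) = etaM a * etaProd l := by
  simp [etaProd]

theorem etaProd_append (l r : List ℤ) : etaProd (l ++ r) = etaProd l * etaProd r := by
  simp [etaProd]

theorem etaProd_singleton (a : ℤ) : etaProd [a] = etaM a := by simp [etaProd]

theorem det_etaProd (l : List ℤ) : (etaProd l).det = 1 := by
  induction l with
  | nil => simp [etaProd_nil]
  | cons a l ih => rw [etaProd_cons, det_mul, ih]; simp [etaM, det_fin_two]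

theorem etaProd_cons_zero_zero (a : ℤ) (l : List ℤ) :
    etaProd (a :: l) 0 0 = a * etaProd l 0 0 - etaProd l 1 0 := by
  simp [etaProd_cons, etaM, Matrix.mul_apply, Fin.sum_univ_two]; ring

theorem etaProd_cons_one (a : ℤ) (l : List ℤ) (k : Fin 2) :
    etaProd (a :: l) 1 k = etaProd l 0 k := by
  simp [etaProd_cons, etaM, Matrix.mul_apply, Fin.sum_univ_two]

theorem etaProd_concat_zero (l : List ℤ) (a : ℤ) (k : Fin 2) :
    etaProd (l ++ [a]) k 0 = a * etaProd l k 0 + etaProd l k 1 := by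
  simp [etaProd_append, etaProd_singleton, etaM, Matrix.mul_apply, Fin.sum_univ_two]; ring

theorem etaProd_concat_one (l : List ℤ) (a : ℤ) (k : Fin 2) :
    etaProd (l ++ [a]) k 1 = -etaProd l k 0 := by
  simp [etaProd_append, etaProd_singleton, etaM, Matrix.mul_apply, Fin.sum_univ_two]

theorem etaProd_reverse (l : List ℤ) :
    etaProd l.reverse = !![1, 0; 0, -1] * (etaProd l)ᵀ * !![1, 0; 0, -1] := by
  induction l with
  | nil => ext i j; fin_cases i <;> fin_cases j <;> simp [etaProd_nil]
  | cons a l ih =>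
    rw [List.reverse_cons, etaProd_append, ih, etaProd_singleton, etaProd_cons]
    ext i j
    simp only [Matrix.mul_apply, Fin.sum_univ_two, transpose_apply]
    fin_cases i <;> fin_cases j <;> simp [etaM] <;> ring

theorem etaProd_reverse_zero_zero (l : List ℤ) : etaProd l.reverse 0 0 = etaProd l 0 0 := by
  simp only [etaProd_reverse, Matrix.mul_apply, Fin.sum_univ_two, transpose_apply]
  simp

theorem IsEta.etaProd_eq {c : List ℤ} (h : IsEta c) : etaProd c = -1 := by
  induction h with
  | base => ext i j; fin_cases i <;> fin_cases j <;> simp [etaProd, etaM]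
  | @rotate c _ ih =>
    cases c with
    | nil => simpa using ih
    | cons a t =>
      rw [etaProd_cons] at ih
      have h1 : etaM a * -etaProd t = 1 := by rw [mul_neg, ih, neg_neg]
      have h2 := mul_eq_one_comm.mp h1
      rw [List.rotate_cons_succ, List.rotate_zero, etaProd_append, etaProd_singleton, ← h2]
      simp
  | reverse _ ih =>
    rw [etaProd_reverse, ih]
    ext i j
    fin_cases i <;> fin_cases j <;> simp
  | @expand a b t _ ih =>
    rw [← ih]
    simp only [etaProd_cons, ← mul_assoc]
    congr 1
    ext i j
    fin_cases i <;> fin_cases j <;> simp [etaM]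
    ring

theorem IsEta.two_le_length {c : List ℤ} (h : IsEta c) : 2 ≤ c.length := by
  induction h with
  | base => simp
  | rotate _ ih => simpa using ih
  | reverse _ ih => simpa using ih
  | expand _ ih => simp

theorem IsEta.entries_pos {c : List ℤ} (h : IsEta c) :
    (∀ a ∈ c, 0 ≤ a) ∧ (3 ≤ c.length → ∀ a ∈ c, 1 ≤ a) := by
  induction h with
  | base => simp
  | rotate _ ih => simpa using ih
  | reverse _ ih => simpa using ih
  | @expand a b t _ ih =>
    obtain ⟨h0, h1⟩ := ih
    have key : ∀ x ∈ (a + 1) :: 1 :: (b + 1) :: t, 1 ≤ x := by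
      intro x hx
      simp only [List.mem_cons, forall_eq_or_imp, List.length_cons] at h0 h1 hx
      rcases hx with rfl | rfl | rfl | hx
      · omega
      · omega
      · omega
      · exact (h1 (by have := List.length_pos_of_mem hx; omega)).2.2 x hx
    exact ⟨fun x hx => by linarith [key x hx], fun _ => key⟩

theorem IsEta.etaProd_infix_pos {c : List ℤ} (h : IsEta c) :
    ∀ x y z : List ℤ, c = x ++ y ++ z → x ≠ [] → z ≠ [] → 1 ≤ etaProd y 0 0 := by
  induction h with
  | base =>
    intro x y z hc hx hz
    have hl := congrArg List.length hc
    have h1 := List.length_pos_of_ne_nil hx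
    have h2 := List.length_pos_of_ne_nil hz
    simp only [List.length_append, List.length_cons, List.length_nil] at hl
    have hy : y = [] := List.length_eq_zero_iff.mp (by omega)
    simp [hy, etaProd_nil]
  | @rotate c hc ih =>
    intro x y z hxyz hx hz
    cases c with
    | nil => simp at hxyz; exact absurd hxyz.1 hx
    | cons a t =>
      rw [List.rotate_cons_succ, List.rotate_zero] at hxyz
      obtain ⟨z, a', rfl⟩ := List.eq_nil_or_concat' z |>.resolve_left hz
      rw [← List.append_assoc] at hxyz
      obtain ⟨ht, ha⟩ := List.append_inj' hxyz rfl
      by_cases hz' : z = []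
      · subst hz'
        obtain ⟨u, w, rfl⟩ := List.eq_nil_or_concat' x |>.resolve_left hx
        have hu := ih [a] u (w :: y) (by simp [ht]) (by simp) (by simp)
        have hp := hc.etaProd_eq
        have hs : a :: t = (a :: (u ++ [w])) ++ y := by simp [ht]
        rw [hs, etaProd_append] at hp
        have hd := det_etaProd (a :: (u ++ [w]))
        rw [det_fin_two] at hd
        have h01 : etaProd (a :: (u ++ [w])) 1 1 = - etaProd u 0 0 := by
          rw [etaProd_cons_one, etaProd_concat_one]
        have e0 := congrFun (congrFun hp 0) 0
        have e1 := congrFun (congrFun hp 1) 0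
        simp only [Matrix.mul_apply, Fin.sum_univ_two, Matrix.neg_apply, Matrix.one_apply_eq,
          Matrix.one_apply_ne (one_ne_zero : (1 : Fin 2) ≠ 0)] at e0 e1
        have : etaProd y 0 0 = etaProd u 0 0 := by
          rw [h01] at e1 hd
          linear_combination (-etaProd u 0 0) * e0 -
            etaProd (a :: (u ++ [w])) 0 1 * e1 - etaProd y 0 0 * hd
        omega
      · exact ih (a :: x) y z (by simp [ht]) (by simp) hz'
  | @reverse c _ ih =>
    intro x y z hxyz hx hz
    rw [← etaProd_reverse_zero_zero]
    refine ih z.reverse y.reverse x.reverse ?_ (by simpa) (by simpa)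
    rw [← List.reverse_reverse c, hxyz]
    simp
  | @expand a b t _ ih =>
    intro x y z hxyz hx hz
    have hnil : (1 : ℤ) ≤ etaProd [] 0 0 := by simp [etaProd_nil]
    rcases x with _ | ⟨_, _ | ⟨_, _ | ⟨_, x⟩⟩⟩
    · exact absurd rfl hx
    · rcases y with _ | ⟨_, _ | ⟨_, y⟩⟩
      · exact hnil
      · simp only [List.cons_append, List.nil_append, List.cons.injEq] at hxyz
        simp [← hxyz.2.1, etaProd, etaM]
      · simp only [List.cons_append, List.nil_append, List.cons.injEq] at hxyz
        obtain ⟨-, rfl, rfl, rfl⟩ := hxyz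
        have := ih [a] (b :: y) z (by simp) (by simp) hz
        rw [etaProd_cons_zero_zero] at this
        rw [etaProd_cons_zero_zero, etaProd_cons_one, etaProd_cons_zero_zero]
        linarith
    · rcases y with _ | ⟨_, y⟩
      · exact hnil
      · simp only [List.cons_append, List.nil_append, List.cons.injEq] at hxyz
        obtain ⟨-, -, rfl, rfl⟩ := hxyz
        have h1 := ih [a] (b :: y) z (by simp) (by simp) hz
        have h2 := ih [a, b] y z (by simp) (by simp) hz
        rw [etaProd_cons_zero_zero] at h1 ⊢
        linarith
    · simp only [List.cons_append, List.cons.injEq] at hxyz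
      obtain ⟨-, -, -, rfl⟩ := hxyz
      exact ih (a :: b :: x) y z (by simp) (by simp) hz

/-- The determinant of a pair of integer vectors. -/
def det2 (u w : ℤ × ℤ) : ℤ := u.1 * w.2 - u.2 * w.1

theorem det2_swap (u w : ℤ × ℤ) : det2 w u = -det2 u w := by simp only [det2]; ring

theorem det2_neg_right (u w : ℤ × ℤ) : det2 u (-w) = -det2 u w := by
  simp only [det2, Prod.fst_neg, Prod.snd_neg]; ring

theorem det2_self (u : ℤ × ℤ) : det2 u u = 0 := by simp only [det2]; ring

/-- The `j`-th vector (1-indexed) of the sequence: the first column of `η(c₁)⋯η(c_{j-1})`. -/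
def etaVec (c : List ℤ) (j : ℕ) : ℤ × ℤ :=
  (etaProd (c.take (j - 1)) 0 0, etaProd (c.take (j - 1)) 1 0)

theorem det2_etaVec (c : List ℤ) {i j : ℕ} (hi : 1 ≤ i) (hij : i ≤ j) :
    det2 (etaVec c i) (etaVec c j) = etaProd ((c.drop (i - 1)).take (j - i)) 1 0 := by
  have hs : c.take (j - 1) = c.take (i - 1) ++ (c.drop (i - 1)).take (j - i) := by
    rw [show j - 1 = (i - 1) + (j - i) by omega, List.take_add]
  have hd := det_etaProd (c.take (i - 1))
  rw [det_fin_two] at hd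
  simp only [det2, etaVec, hs, etaProd_append, Matrix.mul_apply, Fin.sum_univ_two]
  linear_combination etaProd ((c.drop (i - 1)).take (j - i)) 1 0 * hd

theorem phi_eq_det2_of_lt (c : List ℤ) {i j : ℕ} (hi : 1 ≤ i) (hij : i < j) :
    phi c i j = det2 (etaVec c i) (etaVec c j) := by
  rw [det2_etaVec c hi hij.le, phi, if_neg hij.ne, if_pos hij]; rfl

theorem phi_eq_det2_of_gt (c : List ℤ) {i j : ℕ} (hj : 1 ≤ j) (hij : j < i) :
    phi c i j = -det2 (etaVec c i) (etaVec c j) := by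
  rw [← det2_swap, det2_etaVec c hj hij.le, phi, if_neg hij.ne', if_neg hij.not_gt]; rfl

theorem IsEta.det2_etaVec_pos {c : List ℤ} (h : IsEta c) {i j : ℕ} (hi : 1 ≤ i) (hij : i < j)
    (hj : j ≤ c.length) : 1 ≤ det2 (etaVec c i) (etaVec c j) := by
  rw [det2_etaVec c hi hij.le, List.drop_eq_getElem_cons (by omega : i - 1 < c.length),
    show j - i = (j - i - 1) + 1 by omega, List.take_succ_cons, etaProd_cons_one]
  refine h.etaProd_infix_pos (c.take i) _ (c.drop (j - 1)) ?_ ?_ ?_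
  · rw [show i - 1 + 1 = i by omega, ← List.take_add,
      show i + (j - i - 1) = j - 1 by omega, List.take_append_drop]
  · apply List.ne_nil_of_length_pos; rw [List.length_take]; omega
  · apply List.ne_nil_of_length_pos; rw [List.length_drop]; omega

theorem IsEta.phi_eq_abs {c : List ℤ} (h : IsEta c) {i j : ℕ} (hi : i ∈ Icc 1 c.length)
    (hj : j ∈ Icc 1 c.length) : phi c i j = |det2 (etaVec c i) (etaVec c j)| := by
  rw [mem_Icc] at hi hj
  rcases lt_trichotomy i j with hij | rfl | hij
  · rw [phi_eq_det2_of_lt c hi.1 hij,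
      abs_of_nonneg (by linarith [h.det2_etaVec_pos hi.1 hij hj.2])]
  · simp [phi, det2_self]
  · have := h.det2_etaVec_pos hj.1 hij hi.2
    rw [phi_eq_det2_of_gt c hj.1 hij, abs_of_nonpos]
    rw [det2_swap]; linarith

theorem IsEta.det2_etaVec_ne_zero {c : List ℤ} (h : IsEta c) {i j : ℕ}
    (hi : i ∈ Icc 1 c.length) (hj : j ∈ Icc 1 c.length) (hij : i ≠ j) :
    det2 (etaVec c i) (etaVec c j) ≠ 0 := by
  rw [mem_Icc] at hi hj
  rcases lt_or_gt_of_ne hij with hij | hij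
  · have := h.det2_etaVec_pos hi.1 hij hj.2
    omega
  · have := h.det2_etaVec_pos hj.1 hij hi.2
    rw [det2_swap]; omega

/-- The finite, centrally symmetric set of all vectors `±v_j`. -/
def signedVecs (c : List ℤ) : Finset (ℤ × ℤ) :=
  (Icc 1 c.length).image (etaVec c) ∪ (Icc 1 c.length).image (fun j => -etaVec c j)

theorem mem_signedVecs {c : List ℤ} {u : ℤ × ℤ} :
    u ∈ signedVecs c ↔ ∃ j ∈ Icc 1 c.length, u = etaVec c j ∨ u = -etaVec c j := by
  simp only [signedVecs, mem_union, mem_image]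
  constructor
  · rintro (⟨j, hj, rfl⟩ | ⟨j, hj, rfl⟩)
    · exact ⟨j, hj, Or.inl rfl⟩
    · exact ⟨j, hj, Or.inr rfl⟩
  · rintro ⟨j, hj, rfl | rfl⟩
    · exact Or.inl ⟨j, hj, rfl⟩
    · exact Or.inr ⟨j, hj, rfl⟩

theorem neg_mem_signedVecs {c : List ℤ} {u : ℤ × ℤ} (hu : u ∈ signedVecs c) :
    -u ∈ signedVecs c := by
  obtain ⟨j, hj, rfl | rfl⟩ := mem_signedVecs.mp hu
  · exact mem_signedVecs.mpr ⟨j, hj, Or.inr rfl⟩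
  · exact mem_signedVecs.mpr ⟨j, hj, Or.inl (neg_neg _)⟩

theorem etaVec_succ (c : List ℤ) {j : ℕ} (hj : 2 ≤ j) (hj' : j ≤ c.length) :
    entryOf c j • etaVec c j = etaVec c (j + 1) + etaVec c (j - 1) := by
  have h1 : c.take j = c.take (j - 1) ++ [entryOf c j] := by
    rw [entryOf, List.getD_eq_getElem _ _ (by omega : j - 1 < c.length),
      List.take_concat_get', show j - 1 + 1 = j by omega]
  have h2 : c.take (j - 1) = c.take (j - 1 - 1) ++ [entryOf c (j - 1)] := by
    rw [entryOf, List.getD_eq_getElem _ _ (by omega : j - 1 - 1 < c.length),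
      List.take_concat_get', show j - 1 - 1 + 1 = j - 1 by omega]
  have h3 : ∀ k, etaProd (c.take (j - 1)) k 1 = -etaProd (c.take (j - 1 - 1)) k 0 := by
    intro k
    rw [h2, etaProd_concat_one]
  ext <;> simp only [etaVec, Nat.add_sub_cancel, h1, etaProd_concat_zero, h3, Prod.smul_fst,
    Prod.smul_snd, Prod.fst_add, Prod.snd_add, smul_eq_mul] <;> ring

theorem IsEta.etaVec_length_succ {c : List ℤ} (h : IsEta c) :
    etaVec c (c.length + 1) = -etaVec c 1 := by
  ext <;> simp [etaVec, h.etaProd_eq, etaProd_nil]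

theorem IsEta.etaVec_one {c : List ℤ} (h : IsEta c) :
    entryOf c 1 • etaVec c 1 = etaVec c 2 + -etaVec c c.length := by
  have hl := h.two_le_length
  have h1 : c.take 1 = [entryOf c 1] := by
    cases c with
    | nil => simp at hl
    | cons a t => simp [entryOf]
  have hlt : c.length - 1 < c.length := by omega
  obtain ⟨x, h2⟩ : ∃ x, c = c.take (c.length - 1) ++ [x] := by
    refine ⟨c.get ⟨c.length - 1, hlt⟩, ?_⟩
    rw [List.get_eq_getElem, List.take_concat_get', show c.length - 1 + 1 = c.length by omega, List.take_length]
  have h3 : ∀ k, etaProd (c.take (c.length - 1)) k 0 = (1 : Matrix (Fin 2) (Fin 2) ℤ) k 1 := by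
    intro k
    have := etaProd_concat_one (c.take (c.length - 1)) x k
    rw [← h2, h.etaProd_eq, Matrix.neg_apply] at this
    linarith
  ext
  · simp [etaVec, h3, h1, etaProd_nil, etaProd_singleton, etaM]
  · simp [etaVec, h3, h1, etaProd_nil, etaProd_singleton, etaM]

theorem IsEta.exists_neighbours {c : List ℤ} (h : IsEta c) {j : ℕ} (hj : j ∈ Icc 1 c.length) :
    ∃ a ∈ signedVecs c, ∃ b ∈ signedVecs c, entryOf c j • etaVec c j = a + b ∧
      det2 (etaVec c j) a ≠ 0 := by
  have hl := h.two_le_length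
  have hj' := mem_Icc.mp hj
  rcases hj'.1.eq_or_lt with rfl | h1
  · have h2 : 2 ∈ Icc 1 c.length := mem_Icc.mpr ⟨by omega, hl⟩
    exact ⟨_, mem_signedVecs.mpr ⟨2, h2, Or.inl rfl⟩, _,
      mem_signedVecs.mpr ⟨c.length, mem_Icc.mpr ⟨by omega, le_rfl⟩, Or.inr rfl⟩, h.etaVec_one,
      h.det2_etaVec_ne_zero hj h2 (by omega)⟩
  have hpred : j - 1 ∈ Icc 1 c.length := mem_Icc.mpr ⟨by omega, by omega⟩
  refine ⟨_, mem_signedVecs.mpr ⟨j - 1, hpred, Or.inl rfl⟩, etaVec c (j + 1), ?_,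
    (etaVec_succ c h1 hj'.2).trans (add_comm _ _), h.det2_etaVec_ne_zero hj hpred (by omega)⟩
  rcases hj'.2.eq_or_lt with rfl | h2
  · rw [h.etaVec_length_succ]
    exact mem_signedVecs.mpr ⟨1, mem_Icc.mpr ⟨le_rfl, by omega⟩, Or.inr rfl⟩
  · exact mem_signedVecs.mpr ⟨j + 1, mem_Icc.mpr ⟨by omega, h2⟩, Or.inl rfl⟩

/-- The dot product of two integer vectors. -/
def dot2 (u w : ℤ × ℤ) : ℤ := u.1 * w.1 + u.2 * w.2

theorem dot2_self_smul_sub {v u w : ℤ × ℤ} (h : det2 v u = det2 v w) :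
    dot2 v v • (u - w) = (dot2 v u - dot2 v w) • v := by
  simp only [det2] at h
  ext <;> simp only [dot2, Prod.smul_fst, Prod.smul_snd, Prod.fst_sub, Prod.snd_sub, smul_eq_mul]
  · linear_combination (-v.2) * h
  · linear_combination v.1 * h

theorem dot2_self_pos {v u : ℤ × ℤ} (h : det2 v u ≠ 0) : 0 < dot2 v v := by
  by_contra! hv
  simp only [dot2] at hv
  have h1 : v.1 = 0 := by nlinarith [mul_self_nonneg v.1, mul_self_nonneg v.2]
  have h2 : v.2 = 0 := by nlinarith [mul_self_nonneg v.1, mul_self_nonneg v.2]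
  exact h (by simp [det2, h1, h2])

theorem eq_of_det2_eq_of_dot2_eq {v u w : ℤ × ℤ} (hv : 0 < dot2 v v)
    (h : det2 v u = det2 v w) (h' : dot2 v u = dot2 v w) : u = w := by
  have := dot2_self_smul_sub h
  rw [h', sub_self, zero_smul, smul_eq_zero] at this
  exact sub_eq_zero.mp (this.resolve_left hv.ne')

/-- `e` is the end, in direction `v`, of a nondegenerate edge parallel to `v` of the convex hull
of `W`. -/
def IsEdgeEnd (W : Finset (ℤ × ℤ)) (v e : ℤ × ℤ) : Prop :=
  (∀ u ∈ W, det2 v u ≤ det2 v e) ∧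
    ∃ w ∈ W, ∃ r s : ℤ, 0 < r ∧ 0 < s ∧ r • (e - w) = s • v

theorem IsEdgeEnd.neg {W : Finset (ℤ × ℤ)} (hW : ∀ u ∈ W, -u ∈ W) {v e : ℤ × ℤ}
    (h : IsEdgeEnd W v e) : IsEdgeEnd W (-v) (-e) := by
  obtain ⟨h1, w, hw, r, s, hr, hs, h2⟩ := h
  refine ⟨fun u hu => ?_, -w, hW w hw, r, s, hr, hs, ?_⟩
  · have := h1 _ (hW u hu)
    simp only [det2, Prod.fst_neg, Prod.snd_neg] at this ⊢
    linarith
  · rw [smul_neg, ← h2, ← smul_neg]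
    congr 1
    abel

theorem IsEdgeEnd.det2_nonneg {W : Finset (ℤ × ℤ)} {v v' e : ℤ × ℤ}
    (h : IsEdgeEnd W v e) (h' : IsEdgeEnd W v' e) : 0 ≤ det2 v v' := by
  obtain ⟨-, w, hw, r, s, hr, hs, h2⟩ := h'
  have h3 := h.1 w hw
  have e1 := congrArg Prod.fst h2
  have e2 := congrArg Prod.snd h2
  simp only [Prod.smul_fst, Prod.smul_snd, Prod.fst_sub, Prod.snd_sub, smul_eq_mul] at e1 e2
  have h4 : s * det2 v v' = r * (det2 v e - det2 v w) := by
    simp only [det2]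
    linear_combination v.2 * e1 - v.1 * e2
  have h5 : 0 ≤ s * det2 v v' := h4 ▸ mul_nonneg hr.le (sub_nonneg.mpr h3)
  exact nonneg_of_mul_nonneg_right h5 hs

theorem IsEdgeEnd.det2_eq_zero {W : Finset (ℤ × ℤ)} {v v' e : ℤ × ℤ}
    (h : IsEdgeEnd W v e) (h' : IsEdgeEnd W v' e) : det2 v v' = 0 := by
  have h1 := h.det2_nonneg h'
  have h2 := h'.det2_nonneg h
  rw [det2_swap] at h2
  linarith

theorem IsEta.exists_ear_isEdgeEnd {c : List ℤ} (h : IsEta c) {i : ℕ} (hi : i ∈ Icc 1 c.length)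
    (hm : 1 < (mset c i).card) :
    ∃ j ∈ Icc 1 c.length, entryOf c j = 1 ∧
      (IsEdgeEnd (signedVecs c) (etaVec c i) (etaVec c j) ∨
        IsEdgeEnd (signedVecs c) (etaVec c i) (-etaVec c j)) := by
  obtain ⟨j, hj, k, hk, hjk⟩ := one_lt_card.mp hm
  simp only [mset, mem_filter] at hj hk
  obtain ⟨hj, hjmax⟩ := hj
  obtain ⟨hk, hkmax⟩ := hk
  set v := etaVec c i with hv
  set M := phi c i j with hM
  have hkM : phi c i k = M := le_antisymm (hjmax k hk) (hkmax j hj)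
  have hMpos : 0 < M := by
    rcases eq_or_ne i j with rfl | hij
    · rw [← hkM, h.phi_eq_abs hi hk]
      exact abs_pos.mpr (h.det2_etaVec_ne_zero hi hk hjk)
    · rw [hM, h.phi_eq_abs hi hj]
      exact abs_pos.mpr (h.det2_etaVec_ne_zero hi hj hij)
  have hlen : 3 ≤ c.length := by
    have hne : ∀ l, phi c i l = M → l ≠ i := by
      rintro l hl rfl
      simp [phi] at hl
      omega
    have h1 := hne j rfl
    have h2 := hne k hkM
    simp only [mem_Icc] at hi hj hk
    omega
  have hle : ∀ u ∈ signedVecs c, det2 v u ≤ M := by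
    intro u hu
    obtain ⟨l, hl, hlu⟩ := mem_signedVecs.mp hu
    have h1 := hjmax l hl
    rw [h.phi_eq_abs hi hl] at h1
    rcases hlu with rfl | rfl
    · exact (le_abs_self _).trans h1
    · rw [det2_neg_right]
      exact (neg_le_abs _).trans h1
  have hface : ∀ l ∈ Icc 1 c.length, phi c i l = M →
      ∃ u ∈ signedVecs c, det2 v u = M ∧ (u = etaVec c l ∨ u = -etaVec c l) := by
    intro l hl hlM
    rw [h.phi_eq_abs hi hl] at hlM
    rcases abs_choice (det2 (etaVec c i) (etaVec c l)) with h1 | h1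
    · exact ⟨_, mem_signedVecs.mpr ⟨l, hl, Or.inl rfl⟩, h1 ▸ hlM, Or.inl rfl⟩
    · exact ⟨_, mem_signedVecs.mpr ⟨l, hl, Or.inr rfl⟩, by rw [det2_neg_right, ← h1, hlM],
        Or.inr rfl⟩
  obtain ⟨uj, huj, hujM, huj'⟩ := hface j hj rfl
  obtain ⟨uk, huk, hukM, huk'⟩ := hface k hk hkM
  have hujk : uj ≠ uk := by
    intro he
    have h1 := h.det2_etaVec_ne_zero hj hk hjk
    apply h1
    have h2 : det2 uj uk = 0 := by rw [he, det2_self]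
    rcases huj' with rfl | rfl <;> rcases huk' with rfl | rfl <;>
      simp only [det2, Prod.fst_neg, Prod.snd_neg] at h2 ⊢ <;> linarith
  have hvpos : 0 < dot2 v v := dot2_self_pos (u := uj) (by omega)
  obtain ⟨e, he, hemax⟩ := ((signedVecs c).filter (fun u => det2 v u = M)).exists_max_image
    (dot2 v) ⟨uj, mem_filter.mpr ⟨huj, hujM⟩⟩
  obtain ⟨heW, heM⟩ := mem_filter.mp he
  have hend : IsEdgeEnd (signedVecs c) v e := by
    refine ⟨fun u hu => heM ▸ hle u hu, ?_⟩
    obtain ⟨w, hw, hwM, hwe⟩ : ∃ w ∈ signedVecs c, det2 v w = M ∧ w ≠ e := by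
      by_cases h1 : uj = e
      · exact ⟨uk, huk, hukM, fun h2 => hujk (h1.trans h2.symm)⟩
      · exact ⟨uj, huj, hujM, h1⟩
    have h1 : det2 v e = det2 v w := heM.trans hwM.symm
    refine ⟨w, hw, _, _, hvpos, ?_, dot2_self_smul_sub h1⟩
    have h2 := hemax w (mem_filter.mpr ⟨hw, hwM⟩)
    have h3 : dot2 v e ≠ dot2 v w := fun h3 => hwe (eq_of_det2_eq_of_dot2_eq hvpos h1 h3).symm
    omega
  obtain ⟨l, hl, hle'⟩ := mem_signedVecs.mp heW
  refine ⟨l, hl, ?_, ?_⟩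
  swap
  · rcases hle' with h1 | h1
    · exact Or.inl (h1 ▸ hend)
    · exact Or.inr (h1 ▸ hend)
  obtain ⟨a, ha, b, hb, hab, hdet⟩ : ∃ a ∈ signedVecs c, ∃ b ∈ signedVecs c,
      entryOf c l • e = a + b ∧ det2 e a ≠ 0 := by
    obtain ⟨a, ha, b, hb, hab, hdet⟩ := h.exists_neighbours hl
    rcases hle' with rfl | rfl
    · exact ⟨a, ha, b, hb, hab, hdet⟩
    · refine ⟨-a, neg_mem_signedVecs ha, -b, neg_mem_signedVecs hb, ?_, ?_⟩
      · rw [smul_neg, hab, neg_add]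
      · simpa only [det2, Prod.fst_neg, Prod.snd_neg, neg_mul_neg] using hdet
  have hpos : 1 ≤ entryOf c l := by
    refine h.entries_pos.2 hlen _ ?_
    rw [mem_Icc] at hl
    rw [entryOf, List.getD_eq_getElem _ _ (by omega : l - 1 < c.length)]
    exact List.getElem_mem _
  by_contra hne
  have e1 := congrArg Prod.fst hab
  have e2 := congrArg Prod.snd hab
  simp only [Prod.smul_fst, Prod.smul_snd, Prod.fst_add, Prod.snd_add, smul_eq_mul] at e1 e2
  have hsum : entryOf c l * M = det2 v a + det2 v b := by
    rw [← heM]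
    simp only [det2]
    linear_combination v.1 * e2 - v.2 * e1
  have hdot : entryOf c l * dot2 v e = dot2 v a + dot2 v b := by
    simp only [dot2]
    linear_combination v.1 * e1 + v.2 * e2
  have haM := hle a ha
  have hbM := hle b hb
  have htwo : entryOf c l = 2 := by
    have : 2 ≤ entryOf c l := by omega
    nlinarith
  rw [htwo] at hsum hdot
  have haM' : det2 v a = M := by omega
  have hbM' : det2 v b = M := by omega
  have h1 := hemax a (mem_filter.mpr ⟨ha, haM'⟩)
  have h2 := hemax b (mem_filter.mpr ⟨hb, hbM'⟩)
  have hea : e = a := eq_of_det2_eq_of_dot2_eq hvpos (heM.trans haM'.symm) (by omega)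
  exact hdet (by rw [← hea, det2_self])

theorem card_mset_big_le_card_ears (c : List ℤ) (h : IsEta c) :
    ((Finset.Icc 1 c.length).filter (fun i => 1 < (mset c i).card)).card ≤
      ((Finset.Icc 1 c.length).filter (fun i => entryOf c i = 1)).card := by
  refine card_le_card_of_forall_subsingleton
    (fun i j => IsEdgeEnd (signedVecs c) (etaVec c i) (etaVec c j) ∨
      IsEdgeEnd (signedVecs c) (etaVec c i) (-etaVec c j)) ?_ ?_
  · intro i hi
    obtain ⟨hi, hm⟩ := mem_filter.mp hi
    obtain ⟨j, hj, hj1, hij⟩ := h.exists_ear_isEdgeEnd hi hm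
    exact ⟨j, mem_filter.mpr ⟨hj, hj1⟩, hij⟩
  · rintro j - i ⟨hi, hij⟩ k ⟨hk, hkj⟩
    by_contra hik
    apply h.det2_etaVec_ne_zero (mem_filter.mp hi).1 (mem_filter.mp hk).1 hik
    have hW : ∀ u ∈ signedVecs c, -u ∈ signedVecs c := fun u hu => neg_mem_signedVecs hu
    rcases hij with hij | hij <;> rcases hkj with hkj | hkj
    · exact hij.det2_eq_zero hkj
    · have := hij.det2_eq_zero (by simpa using hkj.neg hW)
      rwa [det2_neg_right, neg_eq_zero] at this
    · have := hij.det2_eq_zero (hkj.neg hW)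
      rwa [det2_neg_right, neg_eq_zero] at this
    · exact hij.det2_eq_zero hkj
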